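/- arXiv:2412.08401 — 2 statements merged into one kernel-verified Lean document; each statement's English description precedes it below -/
import Mathlib

section
/- The k-subalgebra of End_k(A) generated by the two elements m_x (multiplication by x) and D is the whole endomorphism algebra End_k(A). -/
open Polynomial

noncomputable section

/-- The truncated polynomial algebra `A = k[X]/(X^p)`. -/
abbrev TruncPoly (k : Type*) [Field k] (p : ℕ) : Type _ :=
  Polynomial k ⧸ Ideal.span {(Polynomial.X : Polynomial k) ^ p}

/-- The image `x` of the variable `X` in `A = k[X]/(X^p)`. -/
def truncX (k : Type*) [Field k] (p : ℕ) : TruncPoly k p :=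
  Ideal.Quotient.mk _ Polynomial.X

theorem truncX_pow_eq_zero (k : Type*) [Field k] {p n : ℕ} (h : p ≤ n) :
    truncX k p ^ n = 0 := by
  rw [truncX, ← map_pow, Ideal.Quotient.eq_zero_iff_mem, Ideal.mem_span_singleton]
  exact pow_dvd_pow _ h

/-- Linear endomorphisms of `k[X]/(X^p)` agree once they agree on `x ^ l` for `l < p`. -/
theorem TruncPoly.linearMap_ext {k : Type*} [Field k] {p : ℕ}
    {f g : Module.End k (TruncPoly k p)}
    (h : ∀ l < p, f (truncX k p ^ l) = g (truncX k p ^ l)) : f = g := by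
  have hcomp : f ∘ₗ (Ideal.Quotient.mkₐ k (Ideal.span {(X : k[X]) ^ p})).toLinearMap =
      g ∘ₗ (Ideal.Quotient.mkₐ k (Ideal.span {(X : k[X]) ^ p})).toLinearMap := by
    refine Polynomial.lhom_ext' fun l => LinearMap.ext_ring ?_
    have hl : f (truncX k p ^ l) = g (truncX k p ^ l) := by
      rcases lt_or_ge l p with hlp | hlp
      · exact h l hlp
      · rw [truncX_pow_eq_zero k hlp, map_zero, map_zero]
    simpa [truncX, Polynomial.monomial_one_right_eq_X_pow] using hl
  refine LinearMap.ext fun a => ?_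
  obtain ⟨P, rfl⟩ := Ideal.Quotient.mk_surjective a
  exact LinearMap.congr_fun hcomp P

theorem mulLeft_mem_of_mulLeft_truncX_mem {k : Type*} [Field k] {p : ℕ}
    {S : Subalgebra k (Module.End k (TruncPoly k p))}
    (hS : LinearMap.mulLeft k (truncX k p) ∈ S) (a : TruncPoly k p) :
    LinearMap.mulLeft k a ∈ S := by
  obtain ⟨P, rfl⟩ := Ideal.Quotient.mk_surjective a
  have haeval : Polynomial.aeval (truncX k p) P = Ideal.Quotient.mk _ P := by
    change Polynomial.aeval (Ideal.Quotient.mkₐ k _ X) P = Ideal.Quotient.mkₐ k _ P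
    rw [Polynomial.aeval_algHom_apply, Polynomial.aeval_X_left_apply]
  rw [← haeval]
  change Algebra.lmul k _ _ ∈ S
  rw [← Polynomial.aeval_algHom_apply]
  exact Algebra.adjoin_le (Set.singleton_subset_iff.2 hS)
    (Polynomial.aeval_mem_adjoin_singleton k _)

theorem pow_apply_truncX_pow {k : Type*} [Field k] {p : ℕ}
    {D : Module.End k (TruncPoly k p)}
    (hD : ∀ i : ℕ, i < p → D (truncX k p ^ i) = -((i : k) • truncX k p ^ (i - 1)))
    {l : ℕ} (hl : l < p) (n : ℕ) :
    (D ^ n) (truncX k p ^ l) =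
      ((-1) ^ n * (l.descFactorial n : k)) • truncX k p ^ (l - n) := by
  induction n with
  | zero => simp
  | succ n ih =>
    rw [pow_succ', Module.End.mul_apply, ih, map_smul, hD _ (by omega), Nat.descFactorial_succ,
      ← neg_smul, smul_smul, Nat.sub_sub]
    congr 1
    push_cast
    ring

/-- The `k`-subalgebra of `End_k(A)` generated by multiplication by `x` and the
Shumakovitch–Wang differential `D` is the whole endomorphism algebra. -/
theorem adjoin_mulX_D_eq_top
    (k : Type*) [Field k] (p : ℕ) [Fact p.Prime] [CharP k p]
    (D : Module.End k (TruncPoly k p))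
    (hD : ∀ i : ℕ, i < p → D (truncX k p ^ i) = -((i : k) • truncX k p ^ (i - 1))) :
    Algebra.adjoin k
      ({(LinearMap.mulLeft k (truncX k p) : Module.End k (TruncPoly k p)), D} :
        Set (Module.End k (TruncPoly k p))) = ⊤ := by
  set S := Algebra.adjoin k
      ({(LinearMap.mulLeft k (truncX k p) : Module.End k (TruncPoly k p)), D} :
        Set (Module.End k (TruncPoly k p)))
  have hp : p.Prime := Fact.out
  have hp0 := hp.pos
  have hX : LinearMap.mulLeft k (truncX k p) ∈ S := Algebra.subset_adjoin (by simp)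
  have hDS : D ∈ S := Algebra.subset_adjoin (by simp)
  set c : k := (-1) ^ (p - 1) * ((p - 1).factorial : k) with hc
  have hc0 : c ≠ 0 := by
    refine mul_ne_zero (pow_ne_zero _ (by simp)) ?_
    rw [Ne, CharP.cast_eq_zero_iff k p, hp.dvd_factorial]
    omega
  rw [eq_top_iff]
  rintro f -
  have hf : f = ∑ j ∈ Finset.range p, c⁻¹ • (LinearMap.mulLeft k (f (truncX k p ^ j)) *
      D ^ (p - 1) * LinearMap.mulLeft k (truncX k p ^ (p - 1 - j))) := by
    refine TruncPoly.linearMap_ext fun l hl => ?_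
    rw [LinearMap.sum_apply, Finset.sum_eq_single_of_mem l (Finset.mem_range.2 hl)]
    · simp only [LinearMap.smul_apply, Module.End.mul_apply, LinearMap.mulLeft_apply, ← pow_add]
      rw [Nat.sub_add_cancel (by omega), pow_apply_truncX_pow hD (by omega),
        Nat.descFactorial_self, ← hc, Nat.sub_self, pow_zero, mul_smul_comm, mul_one,
        inv_smul_smul₀ hc0]
    · intro j hj hjl
      rw [Finset.mem_range] at hj
      simp only [LinearMap.smul_apply, Module.End.mul_apply, LinearMap.mulLeft_apply, ← pow_add]
      rcases lt_or_gt_of_ne hjl with h | h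
      · rw [truncX_pow_eq_zero k (show p ≤ p - 1 - j + l by omega), map_zero, mul_zero, smul_zero]
      · rw [pow_apply_truncX_pow hD (by omega),
          Nat.descFactorial_eq_zero_iff_lt.2 (by omega)]
        simp
  rw [hf]
  exact sum_mem fun j _ => S.smul_mem (mul_mem (mul_mem
    (mulLeft_mem_of_mulLeft_truncX_mem hX _) (pow_mem hDS _))
    (mulLeft_mem_of_mulLeft_truncX_mem hX _)) _
end
end

section
/- For every integer λ, the dual of the dual baby Verma module ∇(λ) is isomorphic to ∇(2p-2-λ): there exists a k-linear isomorphism T from the dual space of ∇(λ) to ∇(2p-2-λ) such that T ∘ (-∂₊(λ)ᵀ) = ∂₊(2p-2-λ) ∘ T, T ∘ (-∂₋(λ)ᵀ) = ∂₋(2p-2-λ) ∘ T, and T ∘ (-∂₀(λ)ᵀ) = ∂₀(2p-2-λ) ∘ T, where ∂•(μ) denote the operators of ∇(μ) and ᵀ denotes the transpose (dual) linear map. -/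
noncomputable section

/-- The defining property of the operators `∂₊, ∂₋, ∂₀` of the dual baby Verma
module `∇(λ)` on the `k`-vector space with basis `v_0, …, v_{p-1}`:
`∂₊(vᵢ) = (i-λ)v_{i+1}`, `∂₋(vᵢ) = -i·v_{i-1}`, `∂₀(vᵢ) = (λ-2i)vᵢ`
(with `v_{-1} = v_p = 0`). -/
def IsDualBabyVermaOps (k : Type*) [Field k] (p : ℕ) (lam : ℤ)
    (Pp Pm P0 : Module.End k (Fin p → k)) : Prop :=
  (∀ i : Fin p, Pp (Pi.single i 1) =
    if h : (i : ℕ) + 1 < p then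
      (((i : ℕ) - lam : ℤ) : k) • (Pi.single (⟨(i : ℕ) + 1, h⟩ : Fin p) 1 : Fin p → k)
    else 0) ∧
  (∀ i : Fin p, Pm (Pi.single i 1) =
    if (i : ℕ) = 0 then 0 else
      (-((i : ℕ) : k)) •
        (Pi.single (⟨(i : ℕ) - 1, lt_of_le_of_lt (Nat.sub_le _ _) i.isLt⟩ : Fin p) 1 :
          Fin p → k)) ∧
  (∀ i : Fin p, P0 (Pi.single i 1) =
    ((lam - 2 * (i : ℕ) : ℤ) : k) • (Pi.single i 1 : Fin p → k))

/-- The linear isomorphism from the dual of `k^n` to `k^n` sending the `j`-th dual basis vector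
to the standard basis vector with the reversed index. -/
def dualRevEquiv (k : Type*) [Field k] (n : ℕ) : Module.Dual k (Fin n → k) ≃ₗ[k] (Fin n → k) :=
  (Pi.basisFun k (Fin n)).dualBasis.equiv (Pi.basisFun k (Fin n)) Fin.revPerm

theorem dualRevEquiv_dualBasis {k : Type*} [Field k] {n : ℕ} (j : Fin n) :
    dualRevEquiv k n ((Pi.basisFun k (Fin n)).dualBasis j) = Pi.single j.rev 1 := by
  rw [dualRevEquiv, Module.Basis.equiv_apply, Fin.revPerm_apply, Pi.basisFun_apply]

theorem dualRevEquiv_apply {k : Type*} [Field k] {n : ℕ} (φ : Module.Dual k (Fin n → k))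
    (i : Fin n) : dualRevEquiv k n φ i = φ (Pi.single i.rev 1) := by
  suffices h : LinearMap.proj i ∘ₗ (dualRevEquiv k n).toLinearMap =
      LinearMap.applyₗ (Pi.single i.rev 1 : Fin n → k) from LinearMap.congr_fun h φ
  refine (Pi.basisFun k (Fin n)).dualBasis.ext fun j => ?_
  rw [LinearMap.comp_apply, LinearEquiv.coe_coe, dualRevEquiv_dualBasis]
  have hij : i = j.rev ↔ j = i.rev := by rw [← Fin.rev_eq_iff, eq_comm]
  simp [Pi.single_apply, hij]

/-- Reversal of indices intertwines `-Aᵀ` with `B` as soon as the matrix entries agree. -/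
theorem dualRevEquiv_comp_neg_dualMap {k : Type*} [Field k] {n : ℕ}
    {A B : Module.End k (Fin n → k)}
    (h : ∀ i j : Fin n, -(A (Pi.single i.rev 1) j) = B (Pi.single j.rev 1) i) :
    (dualRevEquiv k n).toLinearMap ∘ₗ (-A.dualMap) = B ∘ₗ (dualRevEquiv k n).toLinearMap := by
  refine (Pi.basisFun k (Fin n)).dualBasis.ext fun j => ?_
  ext i
  simp only [LinearMap.comp_apply, LinearEquiv.coe_coe, dualRevEquiv_dualBasis, ← h,
    dualRevEquiv_apply]
  simp

/-- For every integer `λ`, the dual of the dual baby Verma module `∇(λ)` is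
isomorphic to `∇(2p-2-λ)`: there is a linear isomorphism `T` from the dual
space of `∇(λ)` to `∇(2p-2-λ)` intertwining the dual operators `-∂•(λ)ᵀ` with
the operators `∂•(2p-2-λ)`. -/
theorem dualBabyVerma_dual_iso
    (k : Type*) [Field k] (p : ℕ) [Fact p.Prime] [CharP k p] (hp2 : 2 < p)
    (lam : ℤ)
    (Pp Pm P0 : Module.End k (Fin p → k))
    (hP : IsDualBabyVermaOps k p lam Pp Pm P0)
    (Qp Qm Q0 : Module.End k (Fin p → k))
    (hQ : IsDualBabyVermaOps k p (2 * (p : ℤ) - 2 - lam) Qp Qm Q0) :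
    ∃ T : Module.Dual k (Fin p → k) ≃ₗ[k] (Fin p → k),
      T.toLinearMap ∘ₗ (-(Pp.dualMap)) = Qp ∘ₗ T.toLinearMap ∧
      T.toLinearMap ∘ₗ (-(Pm.dualMap)) = Qm ∘ₗ T.toLinearMap ∧
      T.toLinearMap ∘ₗ (-(P0.dualMap)) = Q0 ∘ₗ T.toLinearMap := by
  have hp : ((p : ℕ) : k) = 0 := CharP.cast_eq_zero k p
  have hrev : ∀ i : Fin p, ((p - (i + 1) : ℕ) : k) = -1 - (i : ℕ) := fun i => by
    rw [Nat.cast_sub i.isLt]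
    push_cast
    rw [hp]
    ring
  obtain ⟨hPp, hPm, hP0⟩ := hP
  obtain ⟨hQp, hQm, hQ0⟩ := hQ
  refine ⟨dualRevEquiv k p, dualRevEquiv_comp_neg_dualMap fun i j => ?_,
    dualRevEquiv_comp_neg_dualMap fun i j => ?_, dualRevEquiv_comp_neg_dualMap fun i j => ?_⟩
  · have hi := i.isLt
    have hj := j.isLt
    rw [hPp, hQp]
    by_cases hij : (i : ℕ) + j = p
    · have hk : ((i : ℕ) : k) + (j : ℕ) = 0 := by rw [← Nat.cast_add, hij, hp]
      rw [dif_pos (by simp only [Fin.val_rev]; omega),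
        dif_pos (by simp only [Fin.val_rev]; omega)]
      simp only [Pi.smul_apply, Pi.single_apply, Fin.ext_iff, Fin.val_rev]
      rw [if_pos (by omega), if_pos (by omega)]
      push_cast [hrev, hp]
      simp only [smul_eq_mul]
      linear_combination hk
    · split_ifs <;>
        simp only [Pi.smul_apply, Pi.zero_apply, Pi.single_apply, Fin.ext_iff, Fin.val_rev] <;>
        (try rw [if_neg (by omega)]) <;> (try rw [if_neg (by omega)]) <;> simp
  · have hi := i.isLt
    have hj := j.isLt
    rw [hPm, hQm]
    by_cases hij : (i : ℕ) + j + 2 = p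
    · have hk : ((i : ℕ) : k) + (j : ℕ) + 2 = 0 := by
        exact_mod_cast (congrArg (Nat.cast : ℕ → k) hij).trans hp
      rw [if_neg (by simp only [Fin.val_rev]; omega),
        if_neg (by simp only [Fin.val_rev]; omega)]
      simp only [Pi.smul_apply, Pi.single_apply, Fin.ext_iff, Fin.val_rev]
      rw [if_pos (by omega), if_pos (by omega)]
      simp only [hrev, smul_eq_mul]
      linear_combination -hk
    · simp only [Fin.val_rev]
      split_ifs <;>
        simp only [Pi.smul_apply, Pi.zero_apply, Pi.single_apply, Fin.ext_iff] <;>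
        (try rw [if_neg (by omega)]) <;> (try rw [if_neg (by omega)]) <;> simp
  · have hi := i.isLt
    have hj := j.isLt
    rw [hP0, hQ0]
    simp only [Pi.smul_apply, Pi.single_apply, Fin.ext_iff, Fin.val_rev]
    by_cases hij : (i : ℕ) + j + 1 = p
    · have hk : ((i : ℕ) : k) + (j : ℕ) + 1 = 0 := by
        exact_mod_cast (congrArg (Nat.cast : ℕ → k) hij).trans hp
      rw [if_pos (by omega), if_pos (by omega)]
      push_cast [hrev, hp]
      simp only [smul_eq_mul]
      linear_combination -2 * hk
    · rw [if_neg (by omega), if_neg (by omega)]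
      simp
end
end
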